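/- Let G = (N, Σ, P, s) be a generative grammar all of whose productions have non-empty left- and right-hand sides, and let a1, …, an ∈ Σ. Then the following are equivalent: (1) s ⇒*_G a1 … an; (2) !bL1 derives Φ̃_G, Γ̃_G, a1, …, an → s; (3) !L1 derives Φ_G, Γ_G, a1, …, an → s; (4) !wL1 derives Γ_G, a1, …, an → s; (5) L1 + T_G derives a1, …, an → s. -/

import Mathlib

namespace Lambek

/-! ## Formulae of `!bL1` (Lambek calculus with unit, brackets and subexponential) -/

/-- Formulae: primitive types, the unit `1`, `\`, `/`, `·`, `⟨⟩`, `[]⁻¹`, `!`. -/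
inductive Fm : Type
  | var : ℕ → Fm
  | one : Fm
  | ldiv : Fm → Fm → Fm   -- `ldiv A C` is `A \ C`
  | rdiv : Fm → Fm → Fm   -- `rdiv C B` is `C / B`
  | mul : Fm → Fm → Fm    -- `A · B`
  | dia : Fm → Fm         -- `⟨⟩ A`
  | binv : Fm → Fm        -- `[]⁻¹ A`
  | bang : Fm → Fm        -- `! A`

/-- Items of a meta-formula: a formula or a bracketed meta-formula. -/
inductive Item : Type
  | fm : Fm → Item
  | br : List Item → Item

/-- Meta-formulae (configurations): finite ordered sequences of items. -/
abbrev Meta := List Item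

/-- `!A₁, …, !Aₙ` as a meta-formula. -/
def bangs (Φ : List Fm) : Meta := Φ.map (fun F => Item.fm (Fm.bang F))

/-- A meta-formula with a designated (hole) occurrence of a meta-formula,
possibly under nested brackets. -/
inductive Ctx : Type
  | hole : Meta → Meta → Ctx
  | br : Meta → Ctx → Meta → Ctx

/-- Plug a meta-formula into the designated occurrence. -/
def Ctx.fill : Ctx → Meta → Meta
  | Ctx.hole Δ₁ Δ₂, Γ => Δ₁ ++ Γ ++ Δ₂
  | Ctx.br Δ₁ c Δ₂, Γ => Δ₁ ++ (Item.br (c.fill Γ)) :: Δ₂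

/-- Derivability in `!bL1`.  The boolean parameter says whether the rule (cut)
is allowed: `DervB true` is full `!bL1`, `DervB false` is cut-free derivability. -/
inductive DervB : Bool → Meta → Fm → Prop
  | id (cf : Bool) (A : Fm) : DervB cf [Item.fm A] A
  | one_r (cf : Bool) : DervB cf [] Fm.one
  | rdiv_l (cf : Bool) (Δ : Ctx) (Γ : Meta) (B C D : Fm) :
      DervB cf Γ B → DervB cf (Δ.fill [Item.fm C]) D →
      DervB cf (Δ.fill (Item.fm (Fm.rdiv C B) :: Γ)) D
  | rdiv_r (cf : Bool) (Γ : Meta) (B C : Fm) :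
      DervB cf (Γ ++ [Item.fm B]) C → DervB cf Γ (Fm.rdiv C B)
  | ldiv_l (cf : Bool) (Δ : Ctx) (Γ : Meta) (A C D : Fm) :
      DervB cf Γ A → DervB cf (Δ.fill [Item.fm C]) D →
      DervB cf (Δ.fill (Γ ++ [Item.fm (Fm.ldiv A C)])) D
  | ldiv_r (cf : Bool) (Γ : Meta) (A C : Fm) :
      DervB cf (Item.fm A :: Γ) C → DervB cf Γ (Fm.ldiv A C)
  | mul_l (cf : Bool) (Δ : Ctx) (A B D : Fm) :
      DervB cf (Δ.fill [Item.fm A, Item.fm B]) D →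
      DervB cf (Δ.fill [Item.fm (Fm.mul A B)]) D
  | mul_r (cf : Bool) (Γ₁ Γ₂ : Meta) (A B : Fm) :
      DervB cf Γ₁ A → DervB cf Γ₂ B → DervB cf (Γ₁ ++ Γ₂) (Fm.mul A B)
  | one_l (cf : Bool) (Δ : Ctx) (A : Fm) :
      DervB cf (Δ.fill []) A → DervB cf (Δ.fill [Item.fm Fm.one]) A
  | dia_l (cf : Bool) (Δ : Ctx) (A C : Fm) :
      DervB cf (Δ.fill [Item.br [Item.fm A]]) C →
      DervB cf (Δ.fill [Item.fm (Fm.dia A)]) C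
  | dia_r (cf : Bool) (Θ : Meta) (A : Fm) :
      DervB cf Θ A → DervB cf [Item.br Θ] (Fm.dia A)
  | binv_l (cf : Bool) (Δ : Ctx) (A C : Fm) :
      DervB cf (Δ.fill [Item.fm A]) C →
      DervB cf (Δ.fill [Item.br [Item.fm (Fm.binv A)]]) C
  | binv_r (cf : Bool) (Θ : Meta) (A : Fm) :
      DervB cf [Item.br Θ] A → DervB cf Θ (Fm.binv A)
  | bang_l (cf : Bool) (Δ : Ctx) (A B : Fm) :
      DervB cf (Δ.fill [Item.fm A]) B → DervB cf (Δ.fill [Item.fm (Fm.bang A)]) B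
  | bang_r (cf : Bool) (Φ : List Fm) (A : Fm) :
      DervB cf (bangs Φ) A → DervB cf (bangs Φ) (Fm.bang A)
  | contr (cf : Bool) (Δ : Ctx) (Φ : List Fm) (Γ : Meta) (B : Fm) :
      Φ ≠ [] →
      DervB cf (Δ.fill (bangs Φ ++ [Item.br (bangs Φ ++ Γ)])) B →
      DervB cf (Δ.fill (bangs Φ ++ Γ)) B
  | perm1 (cf : Bool) (Δ : Ctx) (A : Fm) (Γ : Meta) (B : Fm) :
      DervB cf (Δ.fill (Item.fm (Fm.bang A) :: Γ)) B →
      DervB cf (Δ.fill (Γ ++ [Item.fm (Fm.bang A)])) B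
  | perm2 (cf : Bool) (Δ : Ctx) (A : Fm) (Γ : Meta) (B : Fm) :
      DervB cf (Δ.fill (Γ ++ [Item.fm (Fm.bang A)])) B →
      DervB cf (Δ.fill (Item.fm (Fm.bang A) :: Γ)) B
  | cut (Δ : Ctx) (Θ : Meta) (A C : Fm) :
      DervB true Θ A → DervB true (Δ.fill [Item.fm A]) C →
      DervB true (Δ.fill Θ) C

/-! ## Bracket-free formulae and the calculi `!L1` and `!wL1` -/

/-- Bracket-free formulae (language of `!L1` / `!wL1`). -/
inductive Fm0 : Type
  | var : ℕ → Fm0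
  | one : Fm0
  | ldiv : Fm0 → Fm0 → Fm0
  | rdiv : Fm0 → Fm0 → Fm0
  | mul : Fm0 → Fm0 → Fm0
  | bang : Fm0 → Fm0

/-- Derivability in `!L1` / `!wL1`.  The first boolean allows the weakening
rule (`DervL true` is `!wL1`, `DervL false` is `!L1`); the second boolean
allows the rule (cut). -/
inductive DervL : Bool → Bool → List Fm0 → Fm0 → Prop
  | id (w cf : Bool) (A : Fm0) : DervL w cf [A] A
  | one_r (w cf : Bool) : DervL w cf [] Fm0.one
  | rdiv_l (w cf : Bool) (Γ Δ₁ Δ₂ : List Fm0) (B C D : Fm0) :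
      DervL w cf Γ B → DervL w cf (Δ₁ ++ C :: Δ₂) D →
      DervL w cf (Δ₁ ++ Fm0.rdiv C B :: (Γ ++ Δ₂)) D
  | rdiv_r (w cf : Bool) (Γ : List Fm0) (B C : Fm0) :
      DervL w cf (Γ ++ [B]) C → DervL w cf Γ (Fm0.rdiv C B)
  | ldiv_l (w cf : Bool) (Γ Δ₁ Δ₂ : List Fm0) (A C D : Fm0) :
      DervL w cf Γ A → DervL w cf (Δ₁ ++ C :: Δ₂) D →
      DervL w cf (Δ₁ ++ Γ ++ Fm0.ldiv A C :: Δ₂) D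
  | ldiv_r (w cf : Bool) (Γ : List Fm0) (A C : Fm0) :
      DervL w cf (A :: Γ) C → DervL w cf Γ (Fm0.ldiv A C)
  | mul_l (w cf : Bool) (Δ₁ Δ₂ : List Fm0) (A B D : Fm0) :
      DervL w cf (Δ₁ ++ A :: B :: Δ₂) D → DervL w cf (Δ₁ ++ Fm0.mul A B :: Δ₂) D
  | mul_r (w cf : Bool) (Γ₁ Γ₂ : List Fm0) (A B : Fm0) :
      DervL w cf Γ₁ A → DervL w cf Γ₂ B → DervL w cf (Γ₁ ++ Γ₂) (Fm0.mul A B)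
  | one_l (w cf : Bool) (Δ₁ Δ₂ : List Fm0) (A : Fm0) :
      DervL w cf (Δ₁ ++ Δ₂) A → DervL w cf (Δ₁ ++ Fm0.one :: Δ₂) A
  | bang_l (w cf : Bool) (Δ₁ Δ₂ : List Fm0) (A B : Fm0) :
      DervL w cf (Δ₁ ++ A :: Δ₂) B → DervL w cf (Δ₁ ++ Fm0.bang A :: Δ₂) B
  | bang_r (w cf : Bool) (Φ : List Fm0) (A : Fm0) :
      DervL w cf (Φ.map Fm0.bang) A → DervL w cf (Φ.map Fm0.bang) (Fm0.bang A)
  | perm1 (w cf : Bool) (Δ₁ Γ Δ₂ : List Fm0) (A B : Fm0) :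
      DervL w cf (Δ₁ ++ Fm0.bang A :: (Γ ++ Δ₂)) B →
      DervL w cf (Δ₁ ++ Γ ++ Fm0.bang A :: Δ₂) B
  | perm2 (w cf : Bool) (Δ₁ Γ Δ₂ : List Fm0) (A B : Fm0) :
      DervL w cf (Δ₁ ++ Γ ++ Fm0.bang A :: Δ₂) B →
      DervL w cf (Δ₁ ++ Fm0.bang A :: (Γ ++ Δ₂)) B
  | contr (w cf : Bool) (Δ₁ Δ₂ : List Fm0) (A B : Fm0) :
      DervL w cf (Δ₁ ++ Fm0.bang A :: Fm0.bang A :: Δ₂) B →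
      DervL w cf (Δ₁ ++ Fm0.bang A :: Δ₂) B
  | weak (cf : Bool) (Δ₁ Δ₂ : List Fm0) (A B : Fm0) :
      DervL true cf (Δ₁ ++ Δ₂) B → DervL true cf (Δ₁ ++ Fm0.bang A :: Δ₂) B
  | cut (w : Bool) (Θ Δ₁ Δ₂ : List Fm0) (A C : Fm0) :
      DervL w true Θ A → DervL w true (Δ₁ ++ A :: Δ₂) C →
      DervL w true (Δ₁ ++ Θ ++ Δ₂) C

/-! ## The Lambek calculus with unit `L1` and theories `L1 + T` -/

/-- Formulae of `L1` (no `!`, no bracket modalities). -/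
inductive Fm1 : Type
  | var : ℕ → Fm1
  | one : Fm1
  | ldiv : Fm1 → Fm1 → Fm1
  | rdiv : Fm1 → Fm1 → Fm1
  | mul : Fm1 → Fm1 → Fm1

/-- Sequents of `L1`. -/
abbrev Seq1 := List Fm1 × Fm1

/-- Derivability in `L1 + T` (sequents of `T` are extra axioms). -/
inductive DervT (T : Set Seq1) : List Fm1 → Fm1 → Prop
  | id (A : Fm1) : DervT T [A] A
  | one_r : DervT T [] Fm1.one
  | ax (Γ : List Fm1) (A : Fm1) : (Γ, A) ∈ T → DervT T Γ A
  | rdiv_l (Γ Δ₁ Δ₂ : List Fm1) (B C D : Fm1) :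
      DervT T Γ B → DervT T (Δ₁ ++ C :: Δ₂) D →
      DervT T (Δ₁ ++ Fm1.rdiv C B :: (Γ ++ Δ₂)) D
  | rdiv_r (Γ : List Fm1) (B C : Fm1) :
      DervT T (Γ ++ [B]) C → DervT T Γ (Fm1.rdiv C B)
  | ldiv_l (Γ Δ₁ Δ₂ : List Fm1) (A C D : Fm1) :
      DervT T Γ A → DervT T (Δ₁ ++ C :: Δ₂) D →
      DervT T (Δ₁ ++ Γ ++ Fm1.ldiv A C :: Δ₂) D
  | ldiv_r (Γ : List Fm1) (A C : Fm1) :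
      DervT T (A :: Γ) C → DervT T Γ (Fm1.ldiv A C)
  | mul_l (Δ₁ Δ₂ : List Fm1) (A B D : Fm1) :
      DervT T (Δ₁ ++ A :: B :: Δ₂) D → DervT T (Δ₁ ++ Fm1.mul A B :: Δ₂) D
  | mul_r (Γ₁ Γ₂ : List Fm1) (A B : Fm1) :
      DervT T Γ₁ A → DervT T Γ₂ B → DervT T (Γ₁ ++ Γ₂) (Fm1.mul A B)
  | one_l (Δ₁ Δ₂ : List Fm1) (A : Fm1) :
      DervT T (Δ₁ ++ Δ₂) A → DervT T (Δ₁ ++ Fm1.one :: Δ₂) A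
  | cut (Θ Δ₁ Δ₂ : List Fm1) (A C : Fm1) :
      DervT T Θ A → DervT T (Δ₁ ++ A :: Δ₂) C →
      DervT T (Δ₁ ++ Θ ++ Δ₂) C

/-- Derivability in `L1 + T` where every application of (cut) must have a
sequent from `T` as one of its premises. -/
inductive DervTr (T : Set Seq1) : List Fm1 → Fm1 → Prop
  | id (A : Fm1) : DervTr T [A] A
  | one_r : DervTr T [] Fm1.one
  | ax (Γ : List Fm1) (A : Fm1) : (Γ, A) ∈ T → DervTr T Γ A
  | rdiv_l (Γ Δ₁ Δ₂ : List Fm1) (B C D : Fm1) :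
      DervTr T Γ B → DervTr T (Δ₁ ++ C :: Δ₂) D →
      DervTr T (Δ₁ ++ Fm1.rdiv C B :: (Γ ++ Δ₂)) D
  | rdiv_r (Γ : List Fm1) (B C : Fm1) :
      DervTr T (Γ ++ [B]) C → DervTr T Γ (Fm1.rdiv C B)
  | ldiv_l (Γ Δ₁ Δ₂ : List Fm1) (A C D : Fm1) :
      DervTr T Γ A → DervTr T (Δ₁ ++ C :: Δ₂) D →
      DervTr T (Δ₁ ++ Γ ++ Fm1.ldiv A C :: Δ₂) D
  | ldiv_r (Γ : List Fm1) (A C : Fm1) :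
      DervTr T (A :: Γ) C → DervTr T Γ (Fm1.ldiv A C)
  | mul_l (Δ₁ Δ₂ : List Fm1) (A B D : Fm1) :
      DervTr T (Δ₁ ++ A :: B :: Δ₂) D → DervTr T (Δ₁ ++ Fm1.mul A B :: Δ₂) D
  | mul_r (Γ₁ Γ₂ : List Fm1) (A B : Fm1) :
      DervTr T Γ₁ A → DervTr T Γ₂ B → DervTr T (Γ₁ ++ Γ₂) (Fm1.mul A B)
  | one_l (Δ₁ Δ₂ : List Fm1) (A : Fm1) :
      DervTr T (Δ₁ ++ Δ₂) A → DervTr T (Δ₁ ++ Fm1.one :: Δ₂) A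
  | cut (Θ Δ₁ Δ₂ : List Fm1) (A C : Fm1) :
      (Θ, A) ∈ T ∨ (Δ₁ ++ A :: Δ₂, C) ∈ T →
      DervTr T Θ A → DervTr T (Δ₁ ++ A :: Δ₂) C →
      DervTr T (Δ₁ ++ Θ ++ Δ₂) C

/-- Derivability in `L1 + T` by a derivation all of whose sequents satisfy
the predicate `Good`. -/
inductive DervTgood (T : Set Seq1) (Good : List Fm1 → Fm1 → Prop) : List Fm1 → Fm1 → Prop
  | id (A : Fm1) : Good [A] A → DervTgood T Good [A] A
  | one_r : Good [] Fm1.one → DervTgood T Good [] Fm1.one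
  | ax (Γ : List Fm1) (A : Fm1) : (Γ, A) ∈ T → Good Γ A → DervTgood T Good Γ A
  | rdiv_l (Γ Δ₁ Δ₂ : List Fm1) (B C D : Fm1) :
      DervTgood T Good Γ B → DervTgood T Good (Δ₁ ++ C :: Δ₂) D →
      Good (Δ₁ ++ Fm1.rdiv C B :: (Γ ++ Δ₂)) D →
      DervTgood T Good (Δ₁ ++ Fm1.rdiv C B :: (Γ ++ Δ₂)) D
  | rdiv_r (Γ : List Fm1) (B C : Fm1) :
      DervTgood T Good (Γ ++ [B]) C → Good Γ (Fm1.rdiv C B) →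
      DervTgood T Good Γ (Fm1.rdiv C B)
  | ldiv_l (Γ Δ₁ Δ₂ : List Fm1) (A C D : Fm1) :
      DervTgood T Good Γ A → DervTgood T Good (Δ₁ ++ C :: Δ₂) D →
      Good (Δ₁ ++ Γ ++ Fm1.ldiv A C :: Δ₂) D →
      DervTgood T Good (Δ₁ ++ Γ ++ Fm1.ldiv A C :: Δ₂) D
  | ldiv_r (Γ : List Fm1) (A C : Fm1) :
      DervTgood T Good (A :: Γ) C → Good Γ (Fm1.ldiv A C) →
      DervTgood T Good Γ (Fm1.ldiv A C)
  | mul_l (Δ₁ Δ₂ : List Fm1) (A B D : Fm1) :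
      DervTgood T Good (Δ₁ ++ A :: B :: Δ₂) D →
      Good (Δ₁ ++ Fm1.mul A B :: Δ₂) D →
      DervTgood T Good (Δ₁ ++ Fm1.mul A B :: Δ₂) D
  | mul_r (Γ₁ Γ₂ : List Fm1) (A B : Fm1) :
      DervTgood T Good Γ₁ A → DervTgood T Good Γ₂ B →
      Good (Γ₁ ++ Γ₂) (Fm1.mul A B) →
      DervTgood T Good (Γ₁ ++ Γ₂) (Fm1.mul A B)
  | one_l (Δ₁ Δ₂ : List Fm1) (A : Fm1) :
      DervTgood T Good (Δ₁ ++ Δ₂) A → Good (Δ₁ ++ Fm1.one :: Δ₂) A →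
      DervTgood T Good (Δ₁ ++ Fm1.one :: Δ₂) A
  | cut (Θ Δ₁ Δ₂ : List Fm1) (A C : Fm1) :
      DervTgood T Good Θ A → DervTgood T Good (Δ₁ ++ A :: Δ₂) C →
      Good (Δ₁ ++ Θ ++ Δ₂) C →
      DervTgood T Good (Δ₁ ++ Θ ++ Δ₂) C

/-- The formula is built from primitive types using only the product `·`. -/
def ProdOnly : Fm1 → Prop
  | Fm1.var _ => True
  | Fm1.mul A B => ProdOnly A ∧ ProdOnly B
  | _ => False

/-- A sequent contains no occurrences of `\`, `/`, `1`. -/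
def ProdOnlySeq (Γ : List Fm1) (A : Fm1) : Prop :=
  (∀ F ∈ Γ, ProdOnly F) ∧ ProdOnly A

/-! ## The bracket-forgetting projection -/

/-- BFP on formulae: delete all `⟨⟩` and `[]⁻¹`. -/
def fmBFP : Fm → Fm0
  | Fm.var n => Fm0.var n
  | Fm.one => Fm0.one
  | Fm.ldiv A B => Fm0.ldiv (fmBFP A) (fmBFP B)
  | Fm.rdiv A B => Fm0.rdiv (fmBFP A) (fmBFP B)
  | Fm.mul A B => Fm0.mul (fmBFP A) (fmBFP B)
  | Fm.dia A => fmBFP A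
  | Fm.binv A => fmBFP A
  | Fm.bang A => Fm0.bang (fmBFP A)

mutual
  /-- BFP on items. -/
  def itemBFP : Item → List Fm0
    | Item.fm A => [fmBFP A]
    | Item.br Γ => metaBFP Γ
  /-- BFP on meta-formulae: delete all brackets. -/
  def metaBFP : List Item → List Fm0
    | [] => []
    | i :: Γ => itemBFP i ++ metaBFP Γ
end

/-! ## Generative grammars (semi-Thue systems) -/

/-- A generative grammar (semi-Thue system) over symbols coded by `ℕ`. -/
structure Grammar where
  nonterminals : Finset ℕ
  terminals : Finset ℕ
  disj : Disjoint nonterminals terminals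
  start : ℕ
  start_mem : start ∈ nonterminals
  prods : Finset (List ℕ × List ℕ)
  prods_wf : ∀ p ∈ prods,
    (∀ c ∈ p.1, c ∈ nonterminals ∪ terminals) ∧
    (∀ c ∈ p.2, c ∈ nonterminals ∪ terminals)

/-- One rewriting step `η α θ ⇒_G η β θ`. -/
def Grammar.Step (G : Grammar) (x y : List ℕ) : Prop :=
  ∃ p ∈ G.prods, ∃ η θ : List ℕ, x = η ++ p.1 ++ θ ∧ y = η ++ p.2 ++ θ

/-- `⇒*_G`: reflexive-transitive closure of `⇒_G`. -/
def Grammar.Derives (G : Grammar) : List ℕ → List ℕ → Prop :=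
  Relation.ReflTransGen G.Step

/-- All productions of `G` have nonempty left- and right-hand sides. -/
def Grammar.NonemptySides (G : Grammar) : Prop :=
  ∀ p ∈ G.prods, p.1 ≠ [] ∧ p.2 ≠ []

/-! ### Encoding grammars into formulae -/

/-- `u₁ · … · u_k` as an `Fm`-formula (`1` for the empty word). -/
def wordFm : List ℕ → Fm
  | [] => Fm.one
  | [a] => Fm.var a
  | a :: b :: rest => Fm.mul (Fm.var a) (wordFm (b :: rest))

/-- `u₁ · … · u_k` as an `Fm0`-formula. -/
def wordFm0 : List ℕ → Fm0
  | [] => Fm0.one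
  | [a] => Fm0.var a
  | a :: b :: rest => Fm0.mul (Fm0.var a) (wordFm0 (b :: rest))

/-- `u₁ · … · u_k` as an `Fm1`-formula. -/
def wordFm1 : List ℕ → Fm1
  | [] => Fm1.one
  | [a] => Fm1.var a
  | a :: b :: rest => Fm1.mul (Fm1.var a) (wordFm1 (b :: rest))

/-- The formula `(u₁·…·u_k) / (v₁·…·v_m)` for a production `u ⇒ v`, in `Fm`. -/
def prodFm (p : List ℕ × List ℕ) : Fm := Fm.rdiv (wordFm p.1) (wordFm p.2)

/-- The formula `(u₁·…·u_k) / (v₁·…·v_m)` for a production `u ⇒ v`, in `Fm0`. -/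
def prodFm0 (p : List ℕ × List ℕ) : Fm0 := Fm0.rdiv (wordFm0 p.1) (wordFm0 p.2)

/-- `Γ_G = !B₁, …, !Bₙ` (bracket-free). -/
noncomputable def GammaG (G : Grammar) : List Fm0 :=
  G.prods.toList.map (fun p => Fm0.bang (prodFm0 p))

/-- `Φ_G = !(1 / !B₁), …, !(1 / !Bₙ)` (bracket-free). -/
noncomputable def PhiG (G : Grammar) : List Fm0 :=
  G.prods.toList.map (fun p => Fm0.bang (Fm0.rdiv Fm0.one (Fm0.bang (prodFm0 p))))

/-- `Γ̃_G = ![]⁻¹B₁, …, ![]⁻¹Bₙ`. -/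
noncomputable def GammaTG (G : Grammar) : Meta :=
  G.prods.toList.map (fun p => Item.fm (Fm.bang (Fm.binv (prodFm p))))

/-- `Φ̃_G = !(1 / ![]⁻¹B₁), …, !(1 / ![]⁻¹Bₙ)`. -/
noncomputable def PhiTG (G : Grammar) : Meta :=
  G.prods.toList.map
    (fun p => Item.fm (Fm.bang (Fm.rdiv Fm.one (Fm.bang (Fm.binv (prodFm p))))))

/-- The theory `T_G = { v₁, …, v_m → u₁·…·u_k : (u ⇒ v) ∈ P }`. -/
def TG (G : Grammar) : Set Seq1 :=
  { q | ∃ p ∈ G.prods, q = (p.2.map Fm1.var, wordFm1 p.1) }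

/-! ## Effective encodings of sequents into `ℕ` -/

/-- An effective injective code of `!bL1`-formulae. -/
def encFm : Fm → ℕ
  | Fm.var n => Nat.pair 0 n
  | Fm.one => Nat.pair 1 0
  | Fm.ldiv A B => Nat.pair 2 (Nat.pair (encFm A) (encFm B))
  | Fm.rdiv A B => Nat.pair 3 (Nat.pair (encFm A) (encFm B))
  | Fm.mul A B => Nat.pair 4 (Nat.pair (encFm A) (encFm B))
  | Fm.dia A => Nat.pair 5 (encFm A)
  | Fm.binv A => Nat.pair 6 (encFm A)
  | Fm.bang A => Nat.pair 7 (encFm A)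

mutual
  /-- An effective injective code of items. -/
  def encItem : Item → ℕ
    | Item.fm A => Nat.pair 0 (encFm A)
    | Item.br Γ => Nat.pair 1 (encMeta Γ)
  /-- An effective injective code of meta-formulae. -/
  def encMeta : List Item → ℕ
    | [] => 0
    | i :: Γ => Nat.pair (encItem i) (encMeta Γ) + 1
end

/-- An effective injective code of `!bL1`-sequents. -/
def encSeqB (Γ : Meta) (A : Fm) : ℕ := Nat.pair (encMeta Γ) (encFm A)

/-- An effective injective code of bracket-free formulae. -/
def encFm0 : Fm0 → ℕ
  | Fm0.var n => Nat.pair 0 n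
  | Fm0.one => Nat.pair 1 0
  | Fm0.ldiv A B => Nat.pair 2 (Nat.pair (encFm0 A) (encFm0 B))
  | Fm0.rdiv A B => Nat.pair 3 (Nat.pair (encFm0 A) (encFm0 B))
  | Fm0.mul A B => Nat.pair 4 (Nat.pair (encFm0 A) (encFm0 B))
  | Fm0.bang A => Nat.pair 5 (encFm0 A)

/-- An effective injective code of `!L1`/`!wL1`-sequents. -/
def encSeq0 (Γ : List Fm0) (A : Fm0) : ℕ :=
  Nat.pair ((Γ.map encFm0).foldr (fun a r => Nat.pair a r + 1) 0) (encFm0 A)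

/-! ## Sizes -/

/-- Size (number of symbols) of a formula. -/
def fmSize : Fm → ℕ
  | Fm.var _ => 1
  | Fm.one => 1
  | Fm.ldiv A B => fmSize A + fmSize B + 1
  | Fm.rdiv A B => fmSize A + fmSize B + 1
  | Fm.mul A B => fmSize A + fmSize B + 1
  | Fm.dia A => fmSize A + 1
  | Fm.binv A => fmSize A + 1
  | Fm.bang A => fmSize A + 1

mutual
  /-- Size of an item. -/
  def itemSize : Item → ℕ
    | Item.fm A => fmSize A
    | Item.br Γ => metaSize Γ + 1
  /-- Size of a meta-formula. -/
  def metaSize : List Item → ℕ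
    | [] => 0
    | i :: Γ => itemSize i + metaSize Γ
end

/-! ## Polarity and the bracket non-negative condition -/

/-- `cleanFm pol A`: the formula `A`, all of whose subformula occurrences have
their polarity in the sequent tracked starting from `pol` (`true` = positive),
contains no `[]⁻¹`-subformula at positive polarity and no `⟨⟩`-subformula at
negative polarity. -/
def cleanFm : Bool → Fm → Prop
  | _, Fm.var _ => True
  | _, Fm.one => True
  | pol, Fm.ldiv A B => cleanFm (!pol) A ∧ cleanFm pol B
  | pol, Fm.rdiv B A => cleanFm pol B ∧ cleanFm (!pol) A
  | pol, Fm.mul A B => cleanFm pol A ∧ cleanFm pol B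
  | pol, Fm.dia A => pol = true ∧ cleanFm pol A
  | pol, Fm.binv A => pol = false ∧ cleanFm pol A
  | pol, Fm.bang A => cleanFm pol A

/-- `bnnFm pol A`: every negative occurrence of a `!`-subformula of `A`
(where `A` itself occurs at polarity `pol` in the sequent) includes no
positive occurrence of `[]⁻¹C` and no negative occurrence of `⟨⟩C`. -/
def bnnFm : Bool → Fm → Prop
  | _, Fm.var _ => True
  | _, Fm.one => True
  | pol, Fm.ldiv A B => bnnFm (!pol) A ∧ bnnFm pol B
  | pol, Fm.rdiv B A => bnnFm pol B ∧ bnnFm (!pol) A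
  | pol, Fm.mul A B => bnnFm pol A ∧ bnnFm pol B
  | pol, Fm.dia A => bnnFm pol A
  | pol, Fm.binv A => bnnFm pol A
  | pol, Fm.bang A => (pol = false → cleanFm false A) ∧ bnnFm pol A

mutual
  /-- The bracket non-negative condition for an item of an antecedent. -/
  def bnnItem : Item → Prop
    | Item.fm A => bnnFm false A
    | Item.br Γ => bnnMeta Γ
  /-- The bracket non-negative condition for an antecedent. -/
  def bnnMeta : List Item → Prop
    | [] => True
    | i :: Γ => bnnItem i ∧ bnnMeta Γ
end

/-- The sequent `Γ → C` obeys the bracket non-negative condition. -/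
def bnnSeq (Γ : Meta) (C : Fm) : Prop := bnnMeta Γ ∧ bnnFm true C

/-! ## The formulation of `!bL1` with the generalized permutation rule -/

/-- `interleave Δ₀ [(A₁,Δ₁), …, (A_k,Δ_k)] = Δ₀, !A₁, Δ₁, …, !A_k, Δ_k`. -/
def interleave : Meta → List (Fm × Meta) → Meta
  | Δ₀, [] => Δ₀
  | Δ₀, (A, Δ) :: rest => Δ₀ ++ Item.fm (Fm.bang A) :: interleave Δ rest

/-- Derivations in the formulation of `!bL1` in which `(perm₁)`, `(perm₂)` are
replaced by the generalized permutation rule `(perm)*`.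
`NDervP cf b n Γ C` means: there is a derivation of `Γ → C` in which
(cut) is allowed only if `cf = true`, no two applications of `(perm)*` are
consecutive, `b` records whether the last rule applied is `(perm)*`, and the
derivation has exactly `n` rule applications (axiom instances included). -/
inductive NDervP : Bool → Bool → ℕ → Meta → Fm → Prop
  | id (cf : Bool) (A : Fm) : NDervP cf false 1 [Item.fm A] A
  | one_r (cf : Bool) : NDervP cf false 1 [] Fm.one
  | rdiv_l (cf b₁ b₂ : Bool) (n₁ n₂ : ℕ) (Δ : Ctx) (Γ : Meta) (B C D : Fm) :
      NDervP cf b₁ n₁ Γ B → NDervP cf b₂ n₂ (Δ.fill [Item.fm C]) D →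
      NDervP cf false (n₁ + n₂ + 1) (Δ.fill (Item.fm (Fm.rdiv C B) :: Γ)) D
  | rdiv_r (cf b : Bool) (n : ℕ) (Γ : Meta) (B C : Fm) :
      NDervP cf b n (Γ ++ [Item.fm B]) C → NDervP cf false (n + 1) Γ (Fm.rdiv C B)
  | ldiv_l (cf b₁ b₂ : Bool) (n₁ n₂ : ℕ) (Δ : Ctx) (Γ : Meta) (A C D : Fm) :
      NDervP cf b₁ n₁ Γ A → NDervP cf b₂ n₂ (Δ.fill [Item.fm C]) D →
      NDervP cf false (n₁ + n₂ + 1) (Δ.fill (Γ ++ [Item.fm (Fm.ldiv A C)])) D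
  | ldiv_r (cf b : Bool) (n : ℕ) (Γ : Meta) (A C : Fm) :
      NDervP cf b n (Item.fm A :: Γ) C → NDervP cf false (n + 1) Γ (Fm.ldiv A C)
  | mul_l (cf b : Bool) (n : ℕ) (Δ : Ctx) (A B D : Fm) :
      NDervP cf b n (Δ.fill [Item.fm A, Item.fm B]) D →
      NDervP cf false (n + 1) (Δ.fill [Item.fm (Fm.mul A B)]) D
  | mul_r (cf b₁ b₂ : Bool) (n₁ n₂ : ℕ) (Γ₁ Γ₂ : Meta) (A B : Fm) :
      NDervP cf b₁ n₁ Γ₁ A → NDervP cf b₂ n₂ Γ₂ B →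
      NDervP cf false (n₁ + n₂ + 1) (Γ₁ ++ Γ₂) (Fm.mul A B)
  | one_l (cf b : Bool) (n : ℕ) (Δ : Ctx) (A : Fm) :
      NDervP cf b n (Δ.fill []) A → NDervP cf false (n + 1) (Δ.fill [Item.fm Fm.one]) A
  | dia_l (cf b : Bool) (n : ℕ) (Δ : Ctx) (A C : Fm) :
      NDervP cf b n (Δ.fill [Item.br [Item.fm A]]) C →
      NDervP cf false (n + 1) (Δ.fill [Item.fm (Fm.dia A)]) C
  | dia_r (cf b : Bool) (n : ℕ) (Θ : Meta) (A : Fm) :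
      NDervP cf b n Θ A → NDervP cf false (n + 1) [Item.br Θ] (Fm.dia A)
  | binv_l (cf b : Bool) (n : ℕ) (Δ : Ctx) (A C : Fm) :
      NDervP cf b n (Δ.fill [Item.fm A]) C →
      NDervP cf false (n + 1) (Δ.fill [Item.br [Item.fm (Fm.binv A)]]) C
  | binv_r (cf b : Bool) (n : ℕ) (Θ : Meta) (A : Fm) :
      NDervP cf b n [Item.br Θ] A → NDervP cf false (n + 1) Θ (Fm.binv A)
  | bang_l (cf b : Bool) (n : ℕ) (Δ : Ctx) (A B : Fm) :
      NDervP cf b n (Δ.fill [Item.fm A]) B →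
      NDervP cf false (n + 1) (Δ.fill [Item.fm (Fm.bang A)]) B
  | bang_r (cf b : Bool) (n : ℕ) (Φ : List Fm) (A : Fm) :
      NDervP cf b n (bangs Φ) A → NDervP cf false (n + 1) (bangs Φ) (Fm.bang A)
  | contr (cf b : Bool) (n : ℕ) (Δ : Ctx) (Φ : List Fm) (Γ : Meta) (B : Fm) :
      Φ ≠ [] →
      NDervP cf b n (Δ.fill (bangs Φ ++ [Item.br (bangs Φ ++ Γ)])) B →
      NDervP cf false (n + 1) (Δ.fill (bangs Φ ++ Γ)) B
  | permStar (cf : Bool) (n : ℕ) (Δ : Ctx) (Δ₀ : Meta) (L L' : List (Fm × Meta)) (C : Fm) :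
      L.map Prod.snd = L'.map Prod.snd →
      (L.map Prod.fst).Perm (L'.map Prod.fst) →
      NDervP cf false n (Δ.fill (interleave Δ₀ L)) C →
      NDervP cf true (n + 1) (Δ.fill (interleave Δ₀ L')) C
  | cut (b₁ b₂ : Bool) (n₁ n₂ : ℕ) (Δ : Ctx) (Θ : Meta) (A C : Fm) :
      NDervP true b₁ n₁ Θ A → NDervP true b₂ n₂ (Δ.fill [Item.fm A]) C →
      NDervP true false (n₁ + n₂ + 1) (Δ.fill Θ) C

/-! ## Rewriting under contexts -/

theorem Grammar.Derives.append_context {G : Grammar} {x y : List ℕ} (h : G.Derives x y)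
    (a b : List ℕ) : G.Derives (a ++ x ++ b) (a ++ y ++ b) := by
  induction h with
  | refl => exact .refl
  | tail _ hs ih =>
    obtain ⟨p, hp, η, θ, rfl, rfl⟩ := hs
    exact ih.tail ⟨p, hp, a ++ η, θ ++ b, by simp, by simp⟩

theorem Grammar.Derives.append {G : Grammar} {x y x' y' : List ℕ} (h : G.Derives x y)
    (h' : G.Derives x' y') : G.Derives (x ++ x') (y ++ y') := by
  have h₁ : G.Derives (x ++ x') (y ++ x') := by simpa using h.append_context [] x'
  have h₂ : G.Derives (y ++ x') (y ++ y') := by simpa using h'.append_context y []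
  exact h₁.trans h₂

theorem Grammar.derives_of_mem_prods {G : Grammar} {p : List ℕ × List ℕ} (hp : p ∈ G.prods) :
    G.Derives p.1 p.2 :=
  .single ⟨p, hp, [], [], by simp, by simp⟩

/-! ## Language semantics over words ordered by rewriting -/

/-- A language is rewriting-closed if it contains every word derivable from its members. -/
def RewriteClosed (G : Grammar) (X : Language ℕ) : Prop :=
  ∀ x ∈ X, ∀ y, G.Derives x y → y ∈ X

/-- The rewriting-closed language interpreting a bracket-free formula. -/
def sem (G : Grammar) : Fm0 → Language ℕ
  | .var n => {w | G.Derives [n] w}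
  | .one => {w | G.Derives [] w}
  | .ldiv A C => {w | ∀ a ∈ sem G A, a ++ w ∈ sem G C}
  | .rdiv C B => {w | ∀ b ∈ sem G B, w ++ b ∈ sem G C}
  | .mul A B => {w | ∃ a ∈ sem G A, ∃ b ∈ sem G B, G.Derives (a ++ b) w}
  | .bang A => {w | [] ∈ sem G A ∧ G.Derives [] w}

/-- The concatenation of the interpretations of the formulae of an antecedent. -/
def semSeq (G : Grammar) (Γ : List Fm0) : Language ℕ := (Γ.map (sem G)).prod

@[simp] theorem semSeq_nil (G : Grammar) : semSeq G [] = 1 := rfl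

@[simp] theorem semSeq_cons (G : Grammar) (A : Fm0) (Γ : List Fm0) :
    semSeq G (A :: Γ) = sem G A * semSeq G Γ := by simp [semSeq]

@[simp] theorem semSeq_append (G : Grammar) (Γ Δ : List Fm0) :
    semSeq G (Γ ++ Δ) = semSeq G Γ * semSeq G Δ := by simp [semSeq]

theorem rewriteClosed_sem (G : Grammar) (A : Fm0) : RewriteClosed G (sem G A) := by
  induction A with
  | var n => exact fun x hx y h => Relation.ReflTransGen.trans hx h
  | one => exact fun x hx y h => Relation.ReflTransGen.trans hx h
  | ldiv A C _ ihC =>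
    exact fun x hx y h a ha => ihC _ (hx a ha) _ (by simpa using h.append_context a [])
  | rdiv C B ihC _ =>
    exact fun x hx y h b hb => ihC _ (hx b hb) _ (by simpa using h.append_context [] b)
  | mul A B _ _ =>
    rintro x ⟨a, ha, b, hb, hab⟩ y h
    exact ⟨a, ha, b, hb, hab.trans h⟩
  | bang A _ => exact fun x hx y h => ⟨hx.1, hx.2.trans h⟩

theorem mem_sem_wordFm0 (G : Grammar) (u w : List ℕ) :
    w ∈ sem G (wordFm0 u) ↔ G.Derives u w := by
  induction u using wordFm0.induct generalizing w with
  | case1 => exact Iff.rfl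
  | case2 a => exact Iff.rfl
  | case3 a b rest ih =>
    constructor
    · rintro ⟨x, hx, y, hy, h⟩
      exact (Grammar.Derives.append (x := [a]) hx ((ih y).1 hy)).trans h
    · exact fun h => ⟨[a], .refl, b :: rest, (ih _).2 .refl, h⟩

theorem derives_of_mem_semSeq_var {G : Grammar} {v w : List ℕ}
    (h : w ∈ semSeq G (v.map Fm0.var)) : G.Derives v w := by
  induction v generalizing w with
  | nil =>
    obtain rfl : w = [] := by simpa using h
    exact .refl
  | cons a v ih =>
    rw [List.map_cons, semSeq_cons, Language.mem_mul] at h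
    obtain ⟨x, hx, y, hy, rfl⟩ := h
    exact Grammar.Derives.append (x := [a]) hx (ih hy)

theorem mem_semSeq_var (G : Grammar) (v : List ℕ) : v ∈ semSeq G (v.map Fm0.var) := by
  induction v with
  | nil => simp
  | cons a v ih =>
    rw [List.map_cons, semSeq_cons]
    exact Language.append_mem_mul (a := [a]) (show G.Derives [a] [a] from .refl) ih

section Residuation

variable {G : Grammar} {X Y Z D : Language ℕ}

theorem semRdiv_mul_le (G : Grammar) (C B : Fm0) : sem G (.rdiv C B) * sem G B ≤ sem G C := by
  intro w hw
  obtain ⟨a, ha, b, hb, rfl⟩ := Language.mem_mul.1 hw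
  exact ha b hb

theorem mul_semLdiv_le (G : Grammar) (A C : Fm0) : sem G A * sem G (.ldiv A C) ≤ sem G C := by
  intro w hw
  obtain ⟨a, ha, b, hb, rfl⟩ := Language.mem_mul.1 hw
  exact hb a ha

theorem sem_rdiv_left {B C : Fm0} (h : Z ≤ sem G B) (h' : X * (sem G C * Y) ≤ D) :
    X * (sem G (.rdiv C B) * (Z * Y)) ≤ D := by
  refine le_trans ?_ h'
  rw [← mul_assoc (sem G _) Z]
  gcongr
  exact (mul_le_mul_right h _).trans (semRdiv_mul_le G C B)

theorem sem_ldiv_left {A C : Fm0} (h : Z ≤ sem G A) (h' : X * (sem G C * Y) ≤ D) :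
    X * (Z * (sem G (.ldiv A C) * Y)) ≤ D := by
  refine le_trans ?_ h'
  rw [← mul_assoc Z]
  gcongr
  exact (mul_le_mul_left h _).trans (mul_semLdiv_le G A C)

theorem sem_rdiv_right {B C : Fm0} (h : X * sem G B ≤ sem G C) : X ≤ sem G (.rdiv C B) :=
  fun _ hw _ hb => h (Language.append_mem_mul hw hb)

theorem sem_ldiv_right {A C : Fm0} (h : sem G A * X ≤ sem G C) : X ≤ sem G (.ldiv A C) :=
  fun _ hw _ ha => h (Language.append_mem_mul ha hw)

theorem sem_mul_left (hD : RewriteClosed G D) {A B : Fm0}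
    (h : X * (sem G A * (sem G B * Y)) ≤ D) : X * (sem G (.mul A B) * Y) ≤ D := by
  intro w hw
  obtain ⟨x, hx, t, ht, rfl⟩ := Language.mem_mul.1 hw
  obtain ⟨c, ⟨a, ha, b, hb, hc⟩, y, hy, rfl⟩ := Language.mem_mul.1 ht
  refine hD (x ++ (a ++ (b ++ y))) (h ?_) _ (by simpa using hc.append_context x y)
  exact Language.append_mem_mul hx
    (Language.append_mem_mul ha (Language.append_mem_mul hb hy))

theorem sem_mul_right {A B : Fm0} (hA : X ≤ sem G A) (hB : Y ≤ sem G B) :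
    X * Y ≤ sem G (.mul A B) := by
  intro w hw
  obtain ⟨a, ha, b, hb, rfl⟩ := Language.mem_mul.1 hw
  exact ⟨a, hA ha, b, hB hb, .refl⟩

theorem one_le_sem_one (G : Grammar) : 1 ≤ sem G .one := by
  intro w hw
  obtain rfl := (Language.mem_one w).1 hw
  exact Relation.ReflTransGen.refl

theorem sem_one_left (hD : RewriteClosed G D) (h : X * Y ≤ D) : X * (sem G .one * Y) ≤ D := by
  intro w hw
  obtain ⟨x, hx, t, ht, rfl⟩ := Language.mem_mul.1 hw
  obtain ⟨c, hc, y, hy, rfl⟩ := Language.mem_mul.1 ht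
  exact hD (x ++ y) (h (Language.append_mem_mul hx hy)) _
    (by simpa using Grammar.Derives.append_context (x := []) hc x y)

theorem sem_bang_left_iff (hD : RewriteClosed G D) {A : Fm0} :
    X * (sem G (.bang A) * Y) ≤ D ↔ ([] ∈ sem G A → X * Y ≤ D) := by
  constructor
  · intro h hA
    refine le_trans ?_ h
    gcongr
    intro y hy
    exact Language.append_mem_mul (a := []) (b := y) ⟨hA, .refl⟩ hy
  · intro h w hw
    have hA : [] ∈ sem G A := by
      obtain ⟨x, -, t, ht, -⟩ := Language.mem_mul.1 hw
      obtain ⟨c, hc, -⟩ := Language.mem_mul.1 ht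
      exact hc.1
    have hle : X * (sem G (.bang A) * Y) ≤ X * (sem G .one * Y) := by
      gcongr
      exact fun z hz => hz.2
    exact sem_one_left hD (h hA) (hle hw)

theorem sem_bang_comm (hD : RewriteClosed G D) {A : Fm0} :
    X * (sem G (.bang A) * (Z * Y)) ≤ D ↔ X * (Z * (sem G (.bang A) * Y)) ≤ D := by
  rw [← mul_assoc X Z, sem_bang_left_iff hD, sem_bang_left_iff hD, mul_assoc]

theorem mul_le_of_nil_mem {A : Fm0} (h : X * (sem G A * Y) ≤ D) (hA : [] ∈ sem G A) :
    X * Y ≤ D := by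
  refine le_trans ?_ h
  gcongr
  exact fun y hy => Language.append_mem_mul (a := []) hA hy

theorem mem_semSeq_bang {Φ : List Fm0} {w : List ℕ} (h : w ∈ semSeq G (Φ.map Fm0.bang)) :
    [] ∈ semSeq G (Φ.map Fm0.bang) ∧ G.Derives [] w := by
  induction Φ generalizing w with
  | nil =>
    obtain rfl : w = [] := by simpa using h
    exact ⟨h, .refl⟩
  | cons A Φ ih =>
    rw [List.map_cons, semSeq_cons] at h ⊢
    obtain ⟨a, ha, b, hb, rfl⟩ := Language.mem_mul.1 h
    exact ⟨Language.append_mem_mul (a := []) (b := []) ⟨ha.1, .refl⟩ (ih hb).1,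
      Grammar.Derives.append (x := []) ha.2 (ih hb).2⟩

end Residuation

theorem sem_cut {X Y Z W D : Language ℕ} (h : Z ≤ W) (h' : X * (W * Y) ≤ D) :
    X * (Z * Y) ≤ D := by
  refine le_trans ?_ h'
  gcongr

theorem semSeq_le_sem_of_dervL (G : Grammar) {w cf : Bool} {Γ : List Fm0} {A : Fm0}
    (h : DervL w cf Γ A) : semSeq G Γ ≤ sem G A := by
  induction h with
  | id => simp
  | one_r => exact one_le_sem_one G
  | rdiv_l _ _ _ _ _ _ _ _ _ _ ih₁ ih₂ => simp at *; exact sem_rdiv_left ih₁ ih₂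
  | rdiv_r _ _ _ _ _ _ ih => simp at *; exact sem_rdiv_right ih
  | ldiv_l _ _ _ _ _ _ _ _ _ _ ih₁ ih₂ => simp at *; exact sem_ldiv_left ih₁ ih₂
  | ldiv_r _ _ _ _ _ _ ih => simp at *; exact sem_ldiv_right ih
  | mul_l _ _ _ _ _ _ _ _ ih => simp at *; exact sem_mul_left (rewriteClosed_sem G _) ih
  | mul_r _ _ _ _ _ _ _ _ ih₁ ih₂ => simp at *; exact sem_mul_right ih₁ ih₂
  | one_l _ _ _ _ _ _ ih => simp at *; exact sem_one_left (rewriteClosed_sem G _) ih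
  | bang_l _ _ _ _ _ _ _ ih =>
    simp at *
    exact (sem_bang_left_iff (rewriteClosed_sem G _)).2 (mul_le_of_nil_mem ih)
  | bang_r _ _ _ _ _ ih =>
    exact fun x hx => ⟨ih (mem_semSeq_bang hx).1, (mem_semSeq_bang hx).2⟩
  | perm1 _ _ _ _ _ _ _ _ ih =>
    simp at *
    exact (sem_bang_comm (rewriteClosed_sem G _)).1 ih
  | perm2 _ _ _ _ _ _ _ _ ih =>
    simp at *
    exact (sem_bang_comm (rewriteClosed_sem G _)).2 ih
  | contr _ _ _ _ _ _ _ ih =>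
    simp at *
    rw [sem_bang_left_iff (rewriteClosed_sem G _)] at *
    exact fun hA => (sem_bang_left_iff (rewriteClosed_sem G _)).1 (ih hA) hA
  | weak _ _ _ _ _ _ ih =>
    simp at *
    exact (sem_bang_left_iff (rewriteClosed_sem G _)).2 fun _ => ih
  | cut _ _ _ _ _ _ _ _ ih₁ ih₂ => simp at *; exact sem_cut ih₁ ih₂

/-- The inclusion of formulae of `L1` into bracket-free formulae. -/
def Fm1.toFm0 : Fm1 → Fm0
  | .var n => .var n
  | .one => .one
  | .ldiv A B => .ldiv A.toFm0 B.toFm0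
  | .rdiv A B => .rdiv A.toFm0 B.toFm0
  | .mul A B => .mul A.toFm0 B.toFm0

theorem toFm0_wordFm1 (u : List ℕ) : (wordFm1 u).toFm0 = wordFm0 u := by
  induction u using wordFm1.induct with
  | case1 => rfl
  | case2 a => rfl
  | case3 a b rest ih => simp [wordFm1, wordFm0, Fm1.toFm0, ih]

theorem semSeq_le_sem_of_dervT (G : Grammar) {Γ : List Fm1} {A : Fm1}
    (h : DervT (TG G) Γ A) : semSeq G (Γ.map Fm1.toFm0) ≤ sem G A.toFm0 := by
  induction h with
  | id => simp
  | one_r => exact one_le_sem_one G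
  | ax Γ A hT =>
    obtain ⟨p, hp, hq⟩ := hT
    obtain ⟨rfl, rfl⟩ := Prod.mk.inj hq
    intro w hw
    rw [List.map_map] at hw
    rw [toFm0_wordFm1]
    exact (mem_sem_wordFm0 G _ _).2 ((Grammar.derives_of_mem_prods hp).trans (derives_of_mem_semSeq_var hw))
  | rdiv_l _ _ _ _ _ _ _ _ ih₁ ih₂ => simp [Fm1.toFm0] at *; exact sem_rdiv_left ih₁ ih₂
  | rdiv_r _ _ _ _ ih => simp at *; exact sem_rdiv_right ih
  | ldiv_l _ _ _ _ _ _ _ _ ih₁ ih₂ => simp [Fm1.toFm0] at *; exact sem_ldiv_left ih₁ ih₂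
  | ldiv_r _ _ _ _ ih => simp at *; exact sem_ldiv_right ih
  | mul_l _ _ _ _ _ _ ih =>
    simp [Fm1.toFm0] at *; exact sem_mul_left (rewriteClosed_sem G _) ih
  | mul_r _ _ _ _ _ _ ih₁ ih₂ => simp at *; exact sem_mul_right ih₁ ih₂
  | one_l _ _ _ _ ih => simp [Fm1.toFm0] at *; exact sem_one_left (rewriteClosed_sem G _) ih
  | cut _ _ _ _ _ _ _ ih₁ ih₂ => simp at *; exact sem_cut ih₁ ih₂

theorem nil_mem_sem_prodFm0 {G : Grammar} {p : List ℕ × List ℕ} (hp : p ∈ G.prods) :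
    [] ∈ sem G (prodFm0 p) := by
  intro b hb
  rw [mem_sem_wordFm0] at hb
  exact (mem_sem_wordFm0 G _ _).2 ((Grammar.derives_of_mem_prods hp).trans hb)

theorem nil_mem_semSeq {G : Grammar} {Γ : List Fm0} (h : ∀ A ∈ Γ, [] ∈ sem G A) :
    [] ∈ semSeq G Γ := by
  induction Γ with
  | nil => simp
  | cons A Γ ih =>
    rw [semSeq_cons]
    exact Language.append_mem_mul (a := []) (b := []) (h A (by simp))
      (ih fun B hB => h B (by simp [hB]))

theorem nil_mem_semSeq_GammaG (G : Grammar) : [] ∈ semSeq G (GammaG G) := by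
  refine nil_mem_semSeq fun A hA => ?_
  obtain ⟨p, hp, rfl⟩ := List.mem_map.1 hA
  exact ⟨nil_mem_sem_prodFm0 (by simpa using hp), .refl⟩

theorem derives_of_dervL {G : Grammar} {w cf : Bool} {Ψ : List Fm0} {as : List ℕ}
    (hΨ : [] ∈ semSeq G Ψ) (h : DervL w cf (Ψ ++ as.map Fm0.var) (Fm0.var G.start)) :
    G.Derives [G.start] as := by
  refine semSeq_le_sem_of_dervL G h ?_
  rw [semSeq_append]
  exact Language.append_mem_mul hΨ (mem_semSeq_var G as)

theorem derives_of_dervT {G : Grammar} {as : List ℕ}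
    (h : DervT (TG G) (as.map Fm1.var) (Fm1.var G.start)) : G.Derives [G.start] as := by
  refine semSeq_le_sem_of_dervT G h ?_
  rw [List.map_map]
  exact mem_semSeq_var G as

/-! ## The bracket-forgetting projection of derivations -/

@[simp] theorem metaBFP_append (Γ Δ : Meta) : metaBFP (Γ ++ Δ) = metaBFP Γ ++ metaBFP Δ := by
  induction Γ with
  | nil => rfl
  | cons i Γ ih => simp [metaBFP, ih]

theorem metaBFP_map_fm {α : Type*} (f : α → Fm) (l : List α) :
    metaBFP (l.map fun a => Item.fm (f a)) = l.map fun a => fmBFP (f a) := by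
  induction l with
  | nil => rfl
  | cons a l ih => simp [metaBFP, itemBFP, ih]

theorem metaBFP_bangs (Φ : List Fm) : metaBFP (bangs Φ) = (Φ.map fmBFP).map Fm0.bang := by
  simp [bangs, metaBFP_map_fm, fmBFP]

theorem exists_metaBFP_fill (Δ : Ctx) :
    ∃ Δ₁ Δ₂, ∀ Γ, metaBFP (Δ.fill Γ) = Δ₁ ++ (metaBFP Γ ++ Δ₂) := by
  induction Δ with
  | hole Δ₁ Δ₂ => exact ⟨metaBFP Δ₁, metaBFP Δ₂, fun Γ => by simp [Ctx.fill]⟩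
  | br Δ₁ c Δ₂ ih =>
    obtain ⟨L, R, h⟩ := ih
    exact ⟨metaBFP Δ₁ ++ L, R ++ metaBFP Δ₂, fun Γ => by
      simp [Ctx.fill, metaBFP, itemBFP, h]⟩

theorem DervL.contr_list {w cf : Bool} {Φ Δ₁ Δ₂ : List Fm0} {B : Fm0}
    (h : DervL w cf (Δ₁ ++ (Φ.map Fm0.bang ++ (Φ.map Fm0.bang ++ Δ₂))) B) :
    DervL w cf (Δ₁ ++ (Φ.map Fm0.bang ++ Δ₂)) B := by
  induction Φ generalizing Δ₁ with
  | nil => simpa using h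
  | cons A Φ ih =>
    have h₁ := DervL.perm2 w cf (Δ₁ ++ [Fm0.bang A]) (Φ.map Fm0.bang)
      (Φ.map Fm0.bang ++ Δ₂) A B (by simpa using h)
    have h₂ := DervL.contr w cf Δ₁ (Φ.map Fm0.bang ++ (Φ.map Fm0.bang ++ Δ₂)) A B
      (by simpa using h₁)
    simpa using ih (Δ₁ := Δ₁ ++ [Fm0.bang A]) (by simpa using h₂)

theorem dervL_metaBFP {cf : Bool} {Γ : Meta} {A : Fm} (h : DervB cf Γ A) :
    DervL false cf (metaBFP Γ) (fmBFP A) := by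
  induction h with
  | id cf A => simpa [metaBFP, itemBFP] using DervL.id false cf (fmBFP A)
  | one_r cf => exact .one_r false cf
  | rdiv_l cf Δ Γ B C D _ _ ih₁ ih₂ =>
    obtain ⟨L, R, hf⟩ := exists_metaBFP_fill Δ
    simp [hf, metaBFP, itemBFP, fmBFP] at *
    exact .rdiv_l _ _ _ _ _ _ _ _ ih₁ ih₂
  | rdiv_r cf Γ B C _ ih =>
    simp [metaBFP, itemBFP] at ih
    exact .rdiv_r _ _ _ _ _ ih
  | ldiv_l cf Δ Γ A C D _ _ ih₁ ih₂ =>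
    obtain ⟨L, R, hf⟩ := exists_metaBFP_fill Δ
    simp [hf, metaBFP, itemBFP, fmBFP] at *
    simpa using DervL.ldiv_l _ _ _ _ _ _ _ _ ih₁ ih₂
  | ldiv_r cf Γ A C _ ih => exact .ldiv_r _ _ _ _ _ ih
  | mul_l cf Δ A B D _ ih =>
    obtain ⟨L, R, hf⟩ := exists_metaBFP_fill Δ
    simp [hf, metaBFP, itemBFP, fmBFP] at *
    exact .mul_l _ _ _ _ _ _ _ ih
  | mul_r cf Γ₁ Γ₂ A B _ _ ih₁ ih₂ => simpa [fmBFP] using DervL.mul_r _ _ _ _ _ _ ih₁ ih₂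
  | one_l cf Δ A _ ih =>
    obtain ⟨L, R, hf⟩ := exists_metaBFP_fill Δ
    simp [hf, metaBFP, itemBFP, fmBFP] at *
    exact .one_l _ _ _ _ _ ih
  | dia_l cf Δ A C _ ih =>
    obtain ⟨L, R, hf⟩ := exists_metaBFP_fill Δ
    simpa [hf, metaBFP, itemBFP, fmBFP] using ih
  | dia_r cf Θ A _ ih => simpa [metaBFP, itemBFP, fmBFP] using ih
  | binv_l cf Δ A C _ ih =>
    obtain ⟨L, R, hf⟩ := exists_metaBFP_fill Δ
    simpa [hf, metaBFP, itemBFP, fmBFP] using ih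
  | binv_r cf Θ A _ ih => simpa [metaBFP, itemBFP, fmBFP] using ih
  | bang_l cf Δ A B _ ih =>
    obtain ⟨L, R, hf⟩ := exists_metaBFP_fill Δ
    simp [hf, metaBFP, itemBFP, fmBFP] at *
    exact .bang_l _ _ _ _ _ _ ih
  | bang_r cf Φ A _ ih =>
    rw [metaBFP_bangs] at *
    exact .bang_r _ _ _ _ ih
  | contr cf Δ Φ Γ B _ _ ih =>
    obtain ⟨L, R, hf⟩ := exists_metaBFP_fill Δ
    simp only [hf, metaBFP, itemBFP, metaBFP_append, metaBFP_bangs, List.append_assoc,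
      List.nil_append] at *
    exact ih.contr_list
  | perm1 cf Δ A Γ B _ ih =>
    obtain ⟨L, R, hf⟩ := exists_metaBFP_fill Δ
    simp [hf, metaBFP, itemBFP, fmBFP] at *
    simpa using DervL.perm1 _ _ _ _ _ _ _ ih
  | perm2 cf Δ A Γ B _ ih =>
    obtain ⟨L, R, hf⟩ := exists_metaBFP_fill Δ
    simp [hf, metaBFP, itemBFP, fmBFP] at *
    exact DervL.perm2 _ _ _ _ _ _ _ (by simpa using ih)
  | cut Δ Θ A C _ _ ih₁ ih₂ =>
    obtain ⟨L, R, hf⟩ := exists_metaBFP_fill Δ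
    simp [hf, metaBFP, itemBFP] at *
    simpa using DervL.cut _ _ _ _ _ _ ih₁ ih₂

theorem fmBFP_wordFm (u : List ℕ) : fmBFP (wordFm u) = wordFm0 u := by
  induction u using wordFm.induct with
  | case1 => rfl
  | case2 a => rfl
  | case3 a b rest ih => simp [wordFm, wordFm0, fmBFP, ih]

theorem metaBFP_PhiTG (G : Grammar) : metaBFP (PhiTG G) = PhiG G := by
  simp [PhiTG, PhiG, metaBFP_map_fm, fmBFP, prodFm, prodFm0, fmBFP_wordFm]

theorem metaBFP_GammaTG (G : Grammar) : metaBFP (GammaTG G) = GammaG G := by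
  simp [GammaTG, GammaG, metaBFP_map_fm, fmBFP, prodFm, prodFm0, fmBFP_wordFm]

/-! ## From `!L1` to `!wL1` -/

theorem DervL.to_weak {w cf : Bool} {Γ : List Fm0} {A : Fm0} (h : DervL w cf Γ A) :
    DervL true cf Γ A := by
  induction h with
  | id => exact .id ..
  | one_r => exact .one_r ..
  | rdiv_l _ _ _ _ _ _ _ _ _ _ ih₁ ih₂ => exact .rdiv_l _ _ _ _ _ _ _ _ ih₁ ih₂
  | rdiv_r _ _ _ _ _ _ ih => exact .rdiv_r _ _ _ _ _ ih
  | ldiv_l _ _ _ _ _ _ _ _ _ _ ih₁ ih₂ => exact .ldiv_l _ _ _ _ _ _ _ _ ih₁ ih₂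
  | ldiv_r _ _ _ _ _ _ ih => exact .ldiv_r _ _ _ _ _ ih
  | mul_l _ _ _ _ _ _ _ _ ih => exact .mul_l _ _ _ _ _ _ _ ih
  | mul_r _ _ _ _ _ _ _ _ ih₁ ih₂ => exact .mul_r _ _ _ _ _ _ ih₁ ih₂
  | one_l _ _ _ _ _ _ ih => exact .one_l _ _ _ _ _ ih
  | bang_l _ _ _ _ _ _ _ ih => exact .bang_l _ _ _ _ _ _ ih
  | bang_r _ _ _ _ _ ih => exact .bang_r _ _ _ _ ih
  | perm1 _ _ _ _ _ _ _ _ ih => exact .perm1 _ _ _ _ _ _ _ ih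
  | perm2 _ _ _ _ _ _ _ _ ih => exact .perm2 _ _ _ _ _ _ _ ih
  | contr _ _ _ _ _ _ _ ih => exact .contr _ _ _ _ _ _ ih
  | weak _ _ _ _ _ _ ih => exact .weak _ _ _ _ _ ih
  | cut _ _ _ _ _ _ _ _ ih₁ ih₂ => exact .cut _ _ _ _ _ _ ih₁ ih₂

theorem DervL.cut_theorems {w : Bool} {Ψ Γ : List Fm0} {C : Fm0}
    (hΨ : ∀ A ∈ Ψ, DervL w true [] A) (h : DervL w true (Ψ ++ Γ) C) : DervL w true Γ C := by
  induction Ψ with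
  | nil => exact h
  | cons A Ψ ih =>
    exact ih (fun B hB => hΨ B (by simp [hB]))
      (DervL.cut w [] [] (Ψ ++ Γ) A C (hΨ A (by simp)) h)

theorem dervL_weak_bang_one_rdiv_bang (cf : Bool) (B : Fm0) :
    DervL true cf [] (.bang (.rdiv .one (.bang B))) :=
  .bang_r true cf [] _ (.rdiv_r _ _ _ _ _ (.weak _ [] [] _ _ (.one_r _ _)))

theorem dervL_weak_of_dervL_PhiG {G : Grammar} {Γ : List Fm0} {C : Fm0}
    (h : DervL false true (PhiG G ++ Γ) C) : DervL true true Γ C := by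
  refine h.to_weak.cut_theorems fun A hA => ?_
  obtain ⟨p, -, rfl⟩ := List.mem_map.1 hA
  exact dervL_weak_bang_one_rdiv_bang _ _

/-! ## Simulating rewriting in `L1 + T_G` -/

theorem DervT.wordFm1_left {T : Set Seq1} {u : List ℕ} {Δ₁ Δ₂ : List Fm1} {C : Fm1}
    (h : DervT T (Δ₁ ++ (u.map Fm1.var ++ Δ₂)) C) : DervT T (Δ₁ ++ wordFm1 u :: Δ₂) C := by
  induction u using wordFm1.induct generalizing Δ₁ with
  | case1 => exact .one_l _ _ _ h
  | case2 a => exact h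
  | case3 a b rest ih =>
    exact .mul_l _ _ _ _ _ (by simpa using ih (Δ₁ := Δ₁ ++ [Fm1.var a]) (by simpa using h))

theorem dervT_of_derives {G : Grammar} {a : ℕ} {w : List ℕ} (h : G.Derives [a] w) :
    DervT (TG G) (w.map Fm1.var) (Fm1.var a) := by
  induction h with
  | refl => exact .id _
  | tail _ hs ih =>
    obtain ⟨p, hp, η, θ, rfl, rfl⟩ := hs
    have h₁ := DervT.wordFm1_left (u := p.1) (Δ₁ := η.map Fm1.var) (Δ₂ := θ.map Fm1.var)
      (by simpa using ih)
    have h₂ : DervT (TG G) (p.2.map Fm1.var) (wordFm1 p.1) := .ax _ _ ⟨p, hp, rfl⟩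
    simpa using DervT.cut _ _ _ _ _ h₂ h₁

/-! ## Simulating rewriting in `!bL1` -/

/-- A word as a meta-formula consisting of primitive types. -/
def wordMeta (u : List ℕ) : Meta := u.map fun a => Item.fm (Fm.var a)

theorem DervB.wordFm_left {cf : Bool} {u : List ℕ} {Δ₁ Δ₂ : Meta} {C : Fm}
    (h : DervB cf (Δ₁ ++ (wordMeta u ++ Δ₂)) C) :
    DervB cf (Δ₁ ++ Item.fm (wordFm u) :: Δ₂) C := by
  induction u using wordFm.induct generalizing Δ₁ with
  | case1 =>
    simpa [Ctx.fill, wordFm] using DervB.one_l cf (.hole Δ₁ Δ₂) C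
      (by simpa [wordMeta, Ctx.fill] using h)
  | case2 a => exact h
  | case3 a b rest ih =>
    have h₁ := ih (Δ₁ := Δ₁ ++ [Item.fm (Fm.var a)]) (by simpa [wordMeta] using h)
    simpa [Ctx.fill, wordFm] using DervB.mul_l cf (.hole Δ₁ Δ₂) (.var a) (wordFm (b :: rest)) C
      (by simpa [Ctx.fill] using h₁)

theorem DervB.wordFm_right (cf : Bool) (u : List ℕ) : DervB cf (wordMeta u) (wordFm u) := by
  induction u using wordFm.induct with
  | case1 => exact .one_r cf
  | case2 a => exact .id cf _
  | case3 a b rest ih => exact .mul_r cf [Item.fm (Fm.var a)] _ _ _ (.id cf _) ih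

/-- Left introduction of `/`, `[]⁻¹` and `!` followed by a contraction into an available copy. -/
theorem DervB.rdiv_l_of_bang_binv {cf : Bool} {A B C : Fm} {Θ Ψ Ξ Δ : Meta}
    (hB : DervB cf Θ B)
    (h : DervB cf (Ψ ++ Item.fm (.bang (.binv (.rdiv A B))) :: (Ξ ++ Item.fm A :: Δ)) C) :
    DervB cf (Ψ ++ Item.fm (.bang (.binv (.rdiv A B))) :: (Ξ ++ (Θ ++ Δ))) C := by
  set F := Fm.binv (.rdiv A B) with hF
  have h₁ := DervB.rdiv_l cf (.hole (Ψ ++ Item.fm (.bang F) :: Ξ) Δ) Θ B A C hB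
    (by simpa [Ctx.fill] using h)
  have h₂ := DervB.binv_l cf (.hole (Ψ ++ Item.fm (.bang F) :: Ξ) (Θ ++ Δ)) (.rdiv A B) C
    (by simpa [Ctx.fill] using h₁)
  have h₃ := DervB.bang_l cf (.br (Ψ ++ Item.fm (.bang F) :: Ξ) (.hole [] []) (Θ ++ Δ)) F C
    (by simpa [Ctx.fill] using h₂)
  have h₄ := DervB.perm1 cf (.hole Ψ (Item.br [Item.fm (.bang F)] :: (Θ ++ Δ))) F Ξ C
    (by simpa [Ctx.fill] using h₃)
  have h₅ := DervB.contr cf (.hole (Ψ ++ Ξ) (Θ ++ Δ)) [F] [] C (by simp)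
    (by simpa [Ctx.fill, bangs] using h₄)
  simpa [Ctx.fill] using DervB.perm2 cf (.hole Ψ (Θ ++ Δ)) F Ξ C
    (by simpa [Ctx.fill, bangs] using h₅)

theorem DervB.one_rdiv_weak {cf : Bool} {A C : Fm} {Δ : Meta} (h : DervB cf Δ C) :
    DervB cf (Item.fm (.bang (.rdiv .one (.bang A))) :: Item.fm (.bang A) :: Δ) C := by
  have h₁ := DervB.one_l cf (.hole [] Δ) C (by simpa [Ctx.fill] using h)
  have h₂ := DervB.rdiv_l cf (.hole [] Δ) [Item.fm (.bang A)] (.bang A) .one C (.id cf _) h₁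
  simpa [Ctx.fill] using DervB.bang_l cf (.hole [] (Item.fm (.bang A) :: Δ)) _ C
    (by simpa [Ctx.fill] using h₂)

theorem DervB.one_rdiv_weak_list {cf : Bool} {α : Type*} (f : α → Fm) (l : List α) {Δ : Meta}
    {C : Fm} (h : DervB cf Δ C) :
    DervB cf (l.map (fun a => Item.fm (.bang (.rdiv .one (.bang (f a))))) ++
      (l.map (fun a => Item.fm (.bang (f a))) ++ Δ)) C := by
  induction l with
  | nil => exact h
  | cons a l ih =>
    set L := l.map (fun a => Item.fm (.bang (.rdiv .one (.bang (f a)))))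
    set R := l.map (fun a => Item.fm (.bang (f a)))
    simpa [Ctx.fill] using DervB.perm1 cf
      (.hole [Item.fm (.bang (.rdiv .one (.bang (f a))))] (R ++ Δ)) (f a) L C
      (by simpa [Ctx.fill] using ih.one_rdiv_weak (A := f a))

theorem dervB_of_derives {G : Grammar} {cf : Bool} {a : ℕ} {w : List ℕ} (h : G.Derives [a] w) :
    DervB cf (PhiTG G ++ GammaTG G ++ wordMeta w) (Fm.var a) := by
  induction h with
  | refl =>
    simpa [PhiTG, GammaTG, wordMeta] using
      DervB.one_rdiv_weak_list (fun p => .binv (prodFm p)) G.prods.toList (.id cf (.var a))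
  | tail _ hs ih =>
    obtain ⟨p, hp, η, θ, rfl, rfl⟩ := hs
    have hmem : Item.fm (.bang (.binv (prodFm p))) ∈ GammaTG G :=
      List.mem_map.2 ⟨p, by simpa using hp, rfl⟩
    obtain ⟨Γ₁, Γ₂, hΓ⟩ := List.append_of_mem hmem
    rw [hΓ] at ih ⊢
    have h₁ := DervB.wordFm_left (u := p.1) (Δ₂ := wordMeta θ)
      (Δ₁ := PhiTG G ++ Γ₁ ++ Item.fm (.bang (.binv (prodFm p))) :: (Γ₂ ++ wordMeta η))
      (by simpa [wordMeta] using ih)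
    simpa [wordMeta, prodFm] using DervB.rdiv_l_of_bang_binv (Ψ := PhiTG G ++ Γ₁)
      (Ξ := Γ₂ ++ wordMeta η) (Δ := wordMeta θ) (DervB.wordFm_right cf p.2)
      (by simpa [prodFm] using h₁)

/-- For a grammar `G` with nonempty-sided productions and a
word `a₁ … aₙ` over `Σ`, the five conditions of the main lemma are
equivalent. -/
theorem main_equivalence (G : Grammar) (hne : G.NonemptySides)
    (as : List ℕ) (has : ∀ a ∈ as, a ∈ G.terminals) :
    List.TFAE
      [ G.Derives [G.start] as,
        DervB true (PhiTG G ++ GammaTG G ++ as.map (fun a => Item.fm (Fm.var a)))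
          (Fm.var G.start),
        DervL false true (PhiG G ++ GammaG G ++ as.map Fm0.var) (Fm0.var G.start),
        DervL true true (GammaG G ++ as.map Fm0.var) (Fm0.var G.start),
        DervT (TG G) (as.map Fm1.var) (Fm1.var G.start) ] := by
  tfae_have 1 → 2 := dervB_of_derives
  tfae_have 2 → 3 := fun h => by
    simpa [metaBFP_PhiTG, metaBFP_GammaTG, metaBFP_map_fm, fmBFP, Function.comp_def]
      using dervL_metaBFP h
  tfae_have 3 → 4 := fun h => dervL_weak_of_dervL_PhiG (by simpa using h)
  tfae_have 4 → 1 := derives_of_dervL (nil_mem_semSeq_GammaG G)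
  tfae_have 1 → 5 := dervT_of_derives
  tfae_have 5 → 1 := derives_of_dervT
  tfae_finish

end Lambek
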